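/- For every α > 1/2, the Sobolev space H^1(G_α) of the diagonal comb graph G_α embeds compactly into L^2(G_α); in particular the Neumann extension H_N (the self-adjoint operator associated with the form f ↦ ∫_{G_α} |f'|² on H^1(G_α)) has compact resolvent and purely discrete spectrum. -/

import Mathlib

open MeasureTheory Set Filter
open scoped ENNReal

/-- A metric graph structure on a metric space `X`: a countable collection of edges,
each parametrised by arc length over `[0, len e]`, together with vertices identified
with edge endpoints; the interiors of distinct edges are disjoint, the edges cover `X`,
and the metric of `X` is the induced path metric (characterised by the fact that the
edge parametrisations are `1`-Lipschitz and `dist x y` is the largest value `u x - u y`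
over all continuous, edgewise `1`-Lipschitz functions `u : X → ℝ`). -/
structure MetricGraphOn (X : Type) [MetricSpace X] where
  V : Type
  E : Type
  countableV : Countable V
  countableE : Countable E
  len : E → ℝ
  len_pos : ∀ e, 0 < len e
  edgeMap : E → ℝ → X
  vertexMap : V → X
  endpoint : E → Bool → V
  edgeMap_cont : ∀ e, ContinuousOn (edgeMap e) (Icc 0 (len e))
  edgeMap_injOn : ∀ e, InjOn (edgeMap e) (Ico 0 (len e))
  edgeMap_zero : ∀ e, edgeMap e 0 = vertexMap (endpoint e false)
  edgeMap_len : ∀ e, edgeMap e (len e) = vertexMap (endpoint e true)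
  interior_disjoint : ∀ e e', e ≠ e' → ∀ s ∈ Ioo 0 (len e), ∀ t ∈ Ioo 0 (len e'),
    edgeMap e s ≠ edgeMap e' t
  interior_not_vertex : ∀ e, ∀ s ∈ Ioo 0 (len e), ∀ v, edgeMap e s ≠ vertexMap v
  vertexMap_inj : Function.Injective vertexMap
  cover : ∀ x : X, ∃ e, ∃ t ∈ Icc 0 (len e), edgeMap e t = x
  dist_le : ∀ e, ∀ s ∈ Icc 0 (len e), ∀ t ∈ Icc 0 (len e),
    dist (edgeMap e s) (edgeMap e t) ≤ |s - t|
  dist_ge : ∀ u : X → ℝ, Continuous u →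
    (∀ e, ∀ s ∈ Icc 0 (len e), ∀ t ∈ Icc 0 (len e),
      |u (edgeMap e s) - u (edgeMap e t)| ≤ |s - t|) →
    ∀ x y, u x - u y ≤ dist x y

namespace MetricGraphOn

variable {X : Type} [MetricSpace X]

/-- The (a.e. defined) derivative of `f` along the edge `e`, in the arc-length
parametrisation of the edge. -/
noncomputable def edgeDeriv (G : MetricGraphOn X) (f : X → ℝ) (e : G.E) : ℝ → ℝ :=
  deriv (f ∘ G.edgeMap e)

/-- The subset of `X` consisting of the (closed) edges in `A`. -/
def subgraphSet (G : MetricGraphOn X) (A : Set G.E) : Set X :=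
  ⋃ e ∈ A, G.edgeMap e '' Icc 0 (G.len e)

/-- `∫_e |f|²` along a single edge. -/
noncomputable def edgeMass (G : MetricGraphOn X) (f : X → ℝ) (e : G.E) : ℝ :=
  ∫ t in Ioo 0 (G.len e), (f (G.edgeMap e t)) ^ 2

/-- `∫_e |f'|²` along a single edge. -/
noncomputable def edgeEnergy (G : MetricGraphOn X) (f : X → ℝ) (e : G.E) : ℝ :=
  ∫ t in Ioo 0 (G.len e), (G.edgeDeriv f e t) ^ 2

/-- Membership in the Sobolev space `H¹` of the subgraph given by the edge set `A`:
continuity on the subgraph, edgewise absolute continuity with square-integrable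
derivative, and finiteness of the total `H¹` norm. -/
def MemH1On (G : MetricGraphOn X) (A : Set G.E) (f : X → ℝ) : Prop :=
  ContinuousOn f (G.subgraphSet A) ∧
  (∀ e ∈ A, IntegrableOn (fun t => (G.edgeDeriv f e t) ^ 2) (Ioo 0 (G.len e))) ∧
  (∀ e ∈ A, ∀ t ∈ Icc (0:ℝ) (G.len e),
    f (G.edgeMap e t) = f (G.edgeMap e 0) + ∫ s in Ioo 0 t, G.edgeDeriv f e s) ∧
  Summable (fun e : A => G.edgeMass f (e : G.E) + G.edgeEnergy f (e : G.E))

/-- Membership in `H¹(G)`. -/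
def MemH1 (G : MetricGraphOn X) (f : X → ℝ) : Prop :=
  Continuous f ∧ G.MemH1On Set.univ f

/-- The squared `L²` norm of `f` over the edges in `A`. -/
noncomputable def l2normSqOn (G : MetricGraphOn X) (A : Set G.E) (f : X → ℝ) : ℝ :=
  ∑' e : A, G.edgeMass f (e : G.E)

/-- The squared `L²` norm of `f'` over the edges in `A`. -/
noncomputable def derivNormSqOn (G : MetricGraphOn X) (A : Set G.E) (f : X → ℝ) : ℝ :=
  ∑' e : A, G.edgeEnergy f (e : G.E)

/-- The squared `L²` norm of `f` on `G`. -/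
noncomputable def l2normSq (G : MetricGraphOn X) (f : X → ℝ) : ℝ :=
  G.l2normSqOn Set.univ f

/-- The squared `L²` norm of `f'` on `G` (the Dirichlet energy of `f`). -/
noncomputable def derivNormSq (G : MetricGraphOn X) (f : X → ℝ) : ℝ :=
  G.derivNormSqOn Set.univ f

/-- The squared `H¹` norm of `f`. -/
noncomputable def h1normSq (G : MetricGraphOn X) (f : X → ℝ) : ℝ :=
  G.l2normSq f + G.derivNormSq f

/-- The `L²` inner product on `G`. -/
noncomputable def l2inner (G : MetricGraphOn X) (f g : X → ℝ) : ℝ :=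
  ∑' e : G.E, ∫ t in Ioo 0 (G.len e), f (G.edgeMap e t) * g (G.edgeMap e t)

/-- The Dirichlet form (inner product of derivatives) on `G`. -/
noncomputable def derivInner (G : MetricGraphOn X) (f g : X → ℝ) : ℝ :=
  ∑' e : G.E, ∫ t in Ioo 0 (G.len e), G.edgeDeriv f e t * G.edgeDeriv g e t

/-- The `k`-th min-max (Courant–Fischer) value of the quadratic form
`f ↦ ∫ |f'|²` (over the edges of `A`) with form domain `K`: the infimum over all
`k`-dimensional subspaces of `K` of the largest Rayleigh quotient on the subspace.
For a self-adjoint Laplacian with purely discrete spectrum this is its `k`-th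
eigenvalue (`k = 1` giving the lowest one). -/
noncomputable def eigenOn (G : MetricGraphOn X) (A : Set G.E) (K : Set (X → ℝ))
    (k : ℕ) : ℝ :=
  sInf { μ : ℝ | ∃ φ : Fin k → X → ℝ, (∀ i, φ i ∈ K) ∧
    LinearIndependent ℝ (fun i => (G.subgraphSet A).restrict (φ i)) ∧
    ∀ c : Fin k → ℝ,
      G.derivNormSqOn A (∑ i, c i • φ i) ≤ μ * G.l2normSqOn A (∑ i, c i • φ i) }

/-- The `k`-th eigenvalue `μ_k(G)` of the Neumann extension (standard
continuity–Kirchhoff conditions at all vertices, Neumann conditions at all ends). -/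
noncomputable def neumannEigen (G : MetricGraphOn X) (k : ℕ) : ℝ :=
  G.eigenOn Set.univ {f | G.MemH1 f} k

/-- `f` vanishes at the point `y` of the completion of `X`. -/
def VanishesAt (f : X → ℝ) (y : UniformSpace.Completion X) : Prop :=
  Tendsto f (comap ((↑) : X → UniformSpace.Completion X) (nhds y)) (nhds 0)

/-- Membership in `H¹₀(G; 𝔙)`: `H¹`-functions vanishing on the set `𝔙` of
vertices and/or ends (viewed inside the completion of `X`). -/
def H10Mem (G : MetricGraphOn X) (𝔙 : Set (UniformSpace.Completion X))
    (f : X → ℝ) : Prop :=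
  G.MemH1 f ∧ ∀ y ∈ 𝔙, VanishesAt f y

/-- The `k`-th eigenvalue `λ_k(G; 𝔙)` of the Laplacian with Dirichlet conditions
on `𝔙` and standard (continuity–Kirchhoff/Neumann) conditions elsewhere. -/
noncomputable def dirichletEigen (G : MetricGraphOn X)
    (𝔙 : Set (UniformSpace.Completion X)) (k : ℕ) : ℝ :=
  G.eigenOn Set.univ {f | G.H10Mem 𝔙 f} k

/-- The set of (topological = graph) ends of `G`, realised as the points of the
completion of `X` that do not belong to `X`. -/
def Ends (_G : MetricGraphOn X) : Set (UniformSpace.Completion X) :=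
  {y | y ∉ Set.range ((↑) : X → UniformSpace.Completion X)}

/-- The set of vertices of `G`, viewed inside the completion of `X`. -/
def vertexPoints (G : MetricGraphOn X) : Set (UniformSpace.Completion X) :=
  Set.range (fun v => ((G.vertexMap v : X) : UniformSpace.Completion X))

/-- The degree of a vertex (loops counted twice). -/
noncomputable def degree (G : MetricGraphOn X) (v : G.V) : ℕ :=
  {p : G.E × Bool | G.endpoint p.1 p.2 = v}.ncard

/-- `G` is locally finite: every vertex has finite degree. -/
def LocallyFinite (G : MetricGraphOn X) : Prop :=
  ∀ v : G.V, {p : G.E × Bool | G.endpoint p.1 p.2 = v}.Finite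

/-- A cycle in `G`: a compact subset homeomorphic to a circle. -/
def IsCycle (_G : MetricGraphOn X) (C : Set X) : Prop :=
  IsCompact C ∧ Nonempty (C ≃ₜ Metric.sphere (0 : ℝ × ℝ) 1)

/-- `G` has (first) Betti number `β`: there is a minimal finite family of `β` cycles
whose union contains every cycle of `G`. -/
def HasBettiNumber (G : MetricGraphOn X) (β : ℕ) : Prop :=
  ∃ 𝒞 : Finset (Set X), 𝒞.card = β ∧ (∀ C ∈ 𝒞, G.IsCycle C) ∧
    (∀ C, G.IsCycle C → C ⊆ ⋃ C' ∈ 𝒞, C') ∧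
    ∀ 𝒞' : Finset (Set X), (∀ C ∈ 𝒞', G.IsCycle C) →
      (∀ C, G.IsCycle C → C ⊆ ⋃ C' ∈ 𝒞', C') → β ≤ 𝒞'.card

/-- The embedding of `K ⊆ H¹(G)` into `L²(G)` is compact: every sequence in `K`
bounded in the `H¹` norm has a subsequence which is Cauchy in the `L²` norm. -/
def CompactlyEmbedded (G : MetricGraphOn X) (K : Set (X → ℝ)) : Prop :=
  ∀ u : ℕ → X → ℝ, (∀ n, u n ∈ K) → (∀ n, G.h1normSq (u n) ≤ 1) →
    ∃ φ : ℕ → ℕ, StrictMono φ ∧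
      ∀ ε : ℝ, 0 < ε → ∃ N, ∀ m, N ≤ m → ∀ n, N ≤ n →
        G.l2normSq (u (φ m) - u (φ n)) ≤ ε

/-- The self-adjoint operator with form `f ↦ ∫ |f'|²` and form domain `K` has
purely discrete spectrum (equivalently, compact resolvent): its min-max values
tend to `+∞`. -/
def HasPurelyDiscreteSpectrumOn (G : MetricGraphOn X) (K : Set (X → ℝ)) : Prop :=
  Tendsto (fun k => G.eigenOn Set.univ K k) atTop atTop

/-- The volume (total length) of a subset `S` of `G`. -/
noncomputable def vol (G : MetricGraphOn X) (S : Set X) : ℝ≥0∞ :=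
  ∑' e : G.E, volume (G.edgeMap e ⁻¹' S ∩ Ioo 0 (G.len e))

/-- The set of vertices incident to some edge in `A`. -/
def vertexSetOf (G : MetricGraphOn X) (A : Set G.E) : Set G.V :=
  {v | ∃ e ∈ A, ∃ b, G.endpoint e b = v}

/-- Membership in `H¹₀(G)`, the closure in `H¹(G)` of the compactly supported
`H¹` functions (the form domain of the Friedrichs extension). -/
def H100Mem (G : MetricGraphOn X) (f : X → ℝ) : Prop :=
  G.MemH1 f ∧ ∃ u : ℕ → X → ℝ, (∀ n, G.MemH1 (u n) ∧ HasCompactSupport (u n)) ∧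
    Tendsto (fun n => G.h1normSq (f - u n)) atTop (nhds 0)

/-- The `k`-th eigenvalue `λ_k(G)` of the Friedrichs extension. -/
noncomputable def friedrichsEigen (G : MetricGraphOn X) (k : ℕ) : ℝ :=
  G.eigenOn Set.univ {f | G.H100Mem f} k

end MetricGraphOn

/-- `G` is the "diagonal comb" metric graph `G_α`: the interval `(0,1]` with a
vertex at each point `n^{-α}` (`n ≥ 1`) carrying a pendant edge ("tooth") of length
`n^{-α}`. Shaft edges are indexed by `Sum.inl n` (the edge from `(n+2)^{-α}` to
`(n+1)^{-α}`), teeth by `Sum.inr n` (the tooth at `(n+1)^{-α}`); `Sum.inl n`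
indexes the shaft vertex at `(n+1)^{-α}` and `Sum.inr n` the tip of the `n`-th
tooth. -/
def IsDiagonalComb {X : Type} [MetricSpace X] (G : MetricGraphOn X) (α : ℝ) : Prop :=
  ∃ (eE : (ℕ ⊕ ℕ) ≃ G.E) (eV : (ℕ ⊕ ℕ) ≃ G.V),
    (∀ n : ℕ, G.len (eE (Sum.inl n)) = ((n : ℝ) + 1) ^ (-α) - ((n : ℝ) + 2) ^ (-α)) ∧
    (∀ n : ℕ, G.len (eE (Sum.inr n)) = ((n : ℝ) + 1) ^ (-α)) ∧
    (∀ n : ℕ, G.endpoint (eE (Sum.inl n)) false = eV (Sum.inl (n + 1)) ∧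
      G.endpoint (eE (Sum.inl n)) true = eV (Sum.inl n)) ∧
    (∀ n : ℕ, G.endpoint (eE (Sum.inr n)) false = eV (Sum.inl n) ∧
      G.endpoint (eE (Sum.inr n)) true = eV (Sum.inr n))

/-- `g` is absolutely continuous on `[0, ℓ]` with square-integrable derivative. -/
def IsEdgeH1 (ℓ : ℝ) (g : ℝ → ℝ) : Prop :=
  AbsolutelyContinuousOnInterval g 0 ℓ ∧ IntegrableOn (fun t => deriv g t ^ 2) (Ioo 0 ℓ)

theorem AbsolutelyContinuousOnInterval.congr_eqOn {f g : ℝ → ℝ} {a b : ℝ}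
    (hf : AbsolutelyContinuousOnInterval f a b) (h : EqOn f g (uIcc a b)) :
    AbsolutelyContinuousOnInterval g a b := by
  rw [absolutelyContinuousOnInterval_iff] at hf ⊢
  intro ε hε
  obtain ⟨δ, hδ, H⟩ := hf ε hε
  refine ⟨δ, hδ, fun E hE hlt => ?_⟩
  have := H E hE hlt
  convert this using 1
  refine Finset.sum_congr rfl fun i hi => ?_
  rw [h (hE.1 i hi).1, h (hE.1 i hi).2]

theorem sq_integral_Ioo_le {g : ℝ → ℝ} {a b : ℝ} (hab : a ≤ b) (hg : IntegrableOn g (Ioo a b))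
    (hg2 : IntegrableOn (fun t => g t ^ 2) (Ioo a b)) :
    (∫ t in Ioo a b, g t) ^ 2 ≤ (b - a) * ∫ t in Ioo a b, g t ^ 2 := by
  rcases hab.eq_or_lt with rfl | hlt
  · simp
  set I := ∫ t in Ioo a b, g t
  set c := I / (b - a)
  have hpos : 0 < b - a := sub_pos.2 hlt
  have h0 : 0 ≤ ∫ t in Ioo a b, (g t - c) ^ 2 :=
    integral_nonneg fun t => sq_nonneg _
  have h1 : ∫ t in Ioo a b, (g t - c) ^ 2
      = (∫ t in Ioo a b, g t ^ 2) - 2 * c * I + (b - a) * c ^ 2 := by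
    have hc : ∫ _ in Ioo a b, c ^ 2 = (b - a) * c ^ 2 := by
      simp [hlt.le]
    have e : ∀ t, (g t - c) ^ 2 = (g t ^ 2 - 2 * c * g t) + c ^ 2 := fun t => by ring
    simp_rw [e]
    have hi := hg.const_mul (2 * c)
    have hi2 : Integrable (fun t => g t ^ 2 - 2 * c * g t) (volume.restrict (Ioo a b)) :=
      hg2.sub hi
    rw [integral_add hi2 (integrable_const _), integral_sub hg2 hi, integral_const_mul,
      hc]
  have hI : I = c * (b - a) := by simp only [c]; field_simp
  rw [h1, hI] at h0
  rw [hI]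
  nlinarith

namespace IsEdgeH1

variable {ℓ : ℝ} {g h : ℝ → ℝ}

theorem integrableOn_deriv (hℓ : 0 ≤ ℓ) (hg : IsEdgeH1 ℓ g) :
    IntegrableOn (deriv g) (Ioo 0 ℓ) := by
  have := hg.1.intervalIntegrable_deriv
  rw [intervalIntegrable_iff_integrableOn_Ioo_of_le hℓ] at this
  exact this

theorem continuousOn (hℓ : 0 ≤ ℓ) (hg : IsEdgeH1 ℓ g) : ContinuousOn g (Icc 0 ℓ) := by
  simpa [uIcc_of_le hℓ] using hg.1.continuousOn

theorem sub_eq_integral (hg : IsEdgeH1 ℓ g) {s t : ℝ} (hs : 0 ≤ s) (hst : s ≤ t)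
    (ht : t ≤ ℓ) : g t - g s = ∫ x in Ioo s t, deriv g x := by
  have h1 : AbsolutelyContinuousOnInterval g s t := hg.1.mono (by
    rw [uIcc_of_le hst, uIcc_of_le (hs.trans (hst.trans ht))]
    exact Icc_subset_Icc hs ht)
  rw [← h1.integral_deriv_eq_sub, intervalIntegral.integral_of_le hst, integral_Ioc_eq_integral_Ioo]

theorem of_eq_integral (hℓ : 0 ≤ ℓ) (h2 : IntegrableOn (fun t => deriv g t ^ 2) (Ioo 0 ℓ))
    (hg : ∀ t ∈ Icc 0 ℓ, g t = g 0 + ∫ s in Ioo 0 t, deriv g s) : IsEdgeH1 ℓ g := by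
  have hm : MemLp (deriv g) 2 (volume.restrict (Ioo 0 ℓ)) :=
    (memLp_two_iff_integrable_sq (measurable_deriv g).aestronglyMeasurable).2 h2
  have hi : IntervalIntegrable (deriv g) volume 0 ℓ := by
    rw [intervalIntegrable_iff_integrableOn_Ioo_of_le hℓ]
    exact hm.integrable (by norm_num)
  have hac := hi.absolutelyContinuousOnInterval_intervalIntegral (c := 0) (by simp)
  have hc : AbsolutelyContinuousOnInterval (fun _ : ℝ => g 0) 0 ℓ :=
    (LipschitzWith.const (g 0)).lipschitzOnWith.absolutelyContinuousOnInterval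
  refine ⟨(hc.add hac).congr_eqOn fun t ht => ?_, h2⟩
  rw [uIcc_of_le hℓ] at ht
  rw [hg t ht, Pi.add_apply, intervalIntegral.integral_of_le ht.1, integral_Ioc_eq_integral_Ioo]

theorem sq_sub_le (hℓ : 0 ≤ ℓ) (hg : IsEdgeH1 ℓ g) {s t : ℝ} (hs : 0 ≤ s) (hst : s ≤ t)
    (ht : t ≤ ℓ) : (g t - g s) ^ 2 ≤ (t - s) * ∫ x in Ioo 0 ℓ, deriv g x ^ 2 := by
  have hsub : Ioo s t ⊆ Ioo 0 ℓ := Ioo_subset_Ioo hs ht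
  rw [hg.sub_eq_integral hs hst ht]
  refine (sq_integral_Ioo_le hst ((hg.integrableOn_deriv hℓ).mono_set hsub)
    (hg.2.mono_set hsub)).trans ?_
  refine mul_le_mul_of_nonneg_left ?_ (sub_nonneg.2 hst)
  exact setIntegral_mono_set hg.2 (Eventually.of_forall fun _ => sq_nonneg _)
    hsub.eventuallyLE

theorem add_ae (hℓ : 0 ≤ ℓ) (hg : IsEdgeH1 ℓ g) (hh : IsEdgeH1 ℓ h) :
    ∀ᵐ t ∂volume.restrict (Ioo 0 ℓ), deriv (g + h) t = deriv g t + deriv h t := by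
  rw [ae_restrict_iff' measurableSet_Ioo]
  filter_upwards [hg.1.ae_differentiableAt, hh.1.ae_differentiableAt] with t h1 h2 ht
  have ht' : t ∈ uIcc 0 ℓ := by rw [uIcc_of_le hℓ]; exact Ioo_subset_Icc_self ht
  exact deriv_add (h1 ht') (h2 ht')

theorem memLp_deriv (hg : IsEdgeH1 ℓ g) : MemLp (deriv g) 2 (volume.restrict (Ioo 0 ℓ)) :=
  (memLp_two_iff_integrable_sq (measurable_deriv g).aestronglyMeasurable).2 hg.2

theorem add (hℓ : 0 ≤ ℓ) (hg : IsEdgeH1 ℓ g) (hh : IsEdgeH1 ℓ h) : IsEdgeH1 ℓ (g + h) := by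
  refine ⟨hg.1.add hh.1, ?_⟩
  refine (hg.memLp_deriv.add hh.memLp_deriv).integrable_sq.congr ?_
  filter_upwards [hg.add_ae hℓ hh] with t ht
  rw [ht, Pi.add_apply]

theorem integral_sq_deriv_add_le (hℓ : 0 ≤ ℓ) (hg : IsEdgeH1 ℓ g) (hh : IsEdgeH1 ℓ h) :
    ∫ t in Ioo 0 ℓ, deriv (g + h) t ^ 2 ≤
      2 * (∫ t in Ioo 0 ℓ, deriv g t ^ 2) + 2 * ∫ t in Ioo 0 ℓ, deriv h t ^ 2 := by
  rw [← integral_const_mul, ← integral_const_mul,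
    ← integral_add (hg.2.const_mul 2) (hh.2.const_mul 2)]
  refine integral_mono_ae (hg.add hℓ hh).2 ((hg.2.const_mul 2).add (hh.2.const_mul 2)) ?_
  filter_upwards [hg.add_ae hℓ hh] with t ht
  simp only [ht]
  nlinarith [sq_nonneg (deriv g t - deriv h t)]

theorem const_mul (c : ℝ) (hg : IsEdgeH1 ℓ g) : IsEdgeH1 ℓ (fun t => c * g t) := by
  refine ⟨hg.1.const_mul c, ?_⟩
  simp only [deriv_const_mul_field, mul_pow]
  exact hg.2.const_mul _

theorem of_lipschitzOnWith {K : NNReal} (hℓ : 0 ≤ ℓ) (hg : LipschitzOnWith K g (Icc 0 ℓ)) :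
    IsEdgeH1 ℓ g := by
  have hg' := hg
  rw [← uIcc_of_le hℓ] at hg'
  refine ⟨hg'.absolutelyContinuousOnInterval, ?_⟩
  refine Measure.integrableOn_of_bounded (M := (K : ℝ) ^ 2) (by simp)
    ((measurable_deriv g).pow_const 2).aestronglyMeasurable ?_
  rw [ae_restrict_iff' measurableSet_Ioo]
  refine Eventually.of_forall fun t ht => ?_
  have := norm_deriv_le_of_lipschitzOn (Icc_mem_nhds ht.1 ht.2) hg
  rw [norm_pow]
  gcongr

/-- Sobolev–Poincaré inequality on an interval: the mass of `g` is controlled by its energy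
and its values at `m` equidistributed points. -/
theorem integral_sq_le (hℓ : 0 < ℓ) (hg : IsEdgeH1 ℓ g) {m : ℕ} (hm : 0 < m) :
    ∫ t in Ioo 0 ℓ, g t ^ 2 ≤ 2 * ℓ ^ 2 / m * (∫ t in Ioo 0 ℓ, deriv g t ^ 2) +
      2 * ℓ * ∑ j ∈ Finset.range m, g (j * (ℓ / m)) ^ 2 := by
  set E := ∫ t in Ioo 0 ℓ, deriv g t ^ 2
  set S := ∑ j ∈ Finset.range m, g (j * (ℓ / m)) ^ 2
  have hm' : (0 : ℝ) < m := by exact_mod_cast hm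
  have hE : 0 ≤ E := integral_nonneg fun _ => sq_nonneg _
  have key : ∀ t ∈ Ioo 0 ℓ, g t ^ 2 ≤ 2 * (ℓ / m) * E + 2 * S := by
    intro t ht
    set j := ⌊t / (ℓ / m)⌋₊
    have hq : 0 < ℓ / m := by positivity
    have h1 : j * (ℓ / m) ≤ t := by
      rw [← le_div_iff₀ hq]
      exact Nat.floor_le (div_nonneg ht.1.le hq.le)
    have h2 : t - j * (ℓ / m) ≤ ℓ / m := by
      have : t / (ℓ / m) < j + 1 := Nat.lt_floor_add_one (t / (ℓ / m))
      rw [div_lt_iff₀ hq, add_mul] at this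
      linarith
    have hj : j < m := by
      rw [Nat.floor_lt (div_nonneg ht.1.le hq.le), div_lt_iff₀ hq]
      field_simp
      exact ht.2
    have h3 := hg.sq_sub_le hℓ.le (by positivity) h1 ht.2.le
    have h4 : (g t - g (j * (ℓ / m))) ^ 2 ≤ ℓ / m * E :=
      h3.trans (mul_le_mul_of_nonneg_right h2 hE)
    have h5 : g (j * (ℓ / m)) ^ 2 ≤ S :=
      Finset.single_le_sum (f := fun j : ℕ => g (j * (ℓ / m)) ^ 2) (fun _ _ => sq_nonneg _)
        (Finset.mem_range.2 hj)
    nlinarith [sq_nonneg (g t - 2 * g (j * (ℓ / m)))]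
  have hint : IntegrableOn (fun t => g t ^ 2) (Ioo 0 ℓ) :=
    (((hg.continuousOn hℓ.le).pow 2).integrableOn_Icc).mono_set Ioo_subset_Icc_self
  calc ∫ t in Ioo 0 ℓ, g t ^ 2 ≤ ∫ _ in Ioo 0 ℓ, (2 * (ℓ / m) * E + 2 * S) :=
        setIntegral_mono_on hint (by simp) measurableSet_Ioo key
    _ = 2 * ℓ ^ 2 / m * E + 2 * ℓ * S := by
        simp [hℓ.le]
        ring

end IsEdgeH1

theorem exists_sum_smul_eq_zero_of_card_lt {X : Type*} {k : ℕ} {S : Finset X}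
    (hk : S.card < k) (φ : Fin k → X → ℝ) :
    ∃ c : Fin k → ℝ, c ≠ 0 ∧ ∀ x ∈ S, (∑ i, c i • φ i) x = 0 := by
  let L : (Fin k → ℝ) →ₗ[ℝ] (S → ℝ) :=
    (LinearMap.funLeft ℝ ℝ ((↑) : S → X)) ∘ₗ Fintype.linearCombination ℝ φ
  have hL : LinearMap.ker L ≠ ⊥ := LinearMap.ker_ne_bot_of_finrank_lt (by simpa using hk)
  obtain ⟨c, hc, hc0⟩ := (Submodule.ne_bot_iff _).1 hL
  refine ⟨c, hc0, fun x hx => ?_⟩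
  have := congrFun (LinearMap.mem_ker.1 hc) ⟨x, hx⟩
  simpa [L, LinearMap.funLeft_apply, Fintype.linearCombination_apply] using this

namespace MetricGraphOn

variable {X : Type} [MetricSpace X] {G : MetricGraphOn X}

theorem edgeMass_nonneg (f : X → ℝ) (e : G.E) : 0 ≤ G.edgeMass f e :=
  integral_nonneg fun _ => sq_nonneg _

theorem edgeEnergy_nonneg (f : X → ℝ) (e : G.E) : 0 ≤ G.edgeEnergy f e :=
  integral_nonneg fun _ => sq_nonneg _

theorem l2normSq_eq_tsum (f : X → ℝ) : G.l2normSq f = ∑' e, G.edgeMass f e :=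
  tsum_univ (fun e => G.edgeMass f e)

theorem derivNormSq_eq_tsum (f : X → ℝ) : G.derivNormSq f = ∑' e, G.edgeEnergy f e :=
  tsum_univ (fun e => G.edgeEnergy f e)

theorem l2normSq_nonneg (f : X → ℝ) : 0 ≤ G.l2normSq f :=
  tsum_nonneg fun _ => edgeMass_nonneg _ _

theorem derivNormSq_nonneg (f : X → ℝ) : 0 ≤ G.derivNormSq f :=
  tsum_nonneg fun _ => edgeEnergy_nonneg _ _

theorem memH1_iff {f : X → ℝ} : G.MemH1 f ↔ Continuous f ∧
    (∀ e, IsEdgeH1 (G.len e) (f ∘ G.edgeMap e)) ∧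
      Summable (fun e => G.edgeMass f e + G.edgeEnergy f e) := by
  have hs : Summable (fun e : (univ : Set G.E) => G.edgeMass f e + G.edgeEnergy f e) ↔
      Summable (fun e => G.edgeMass f e + G.edgeEnergy f e) :=
    (Equiv.Set.univ G.E).summable_iff (f := fun e => G.edgeMass f e + G.edgeEnergy f e)
  constructor
  · rintro ⟨hc, -, h1, h2, h3⟩
    exact ⟨hc, fun e => IsEdgeH1.of_eq_integral (G.len_pos e).le (h1 e trivial) (h2 e trivial),
      hs.1 h3⟩
  · rintro ⟨hc, h1, h2⟩
    refine ⟨hc, hc.continuousOn, fun e _ => (h1 e).2, fun e _ t ht => ?_, hs.2 h2⟩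
    have := (h1 e).sub_eq_integral le_rfl ht.1 ht.2
    simp only [edgeDeriv, Function.comp_apply] at this ⊢
    linarith

namespace MemH1

variable {f g : X → ℝ}

theorem isEdgeH1 (hf : G.MemH1 f) (e : G.E) : IsEdgeH1 (G.len e) (f ∘ G.edgeMap e) :=
  (memH1_iff.1 hf).2.1 e

theorem summable_edgeMass (hf : G.MemH1 f) : Summable (G.edgeMass f) :=
  (memH1_iff.1 hf).2.2.of_nonneg_of_le (edgeMass_nonneg f)
    fun e => le_add_of_nonneg_right (edgeEnergy_nonneg f e)

theorem summable_edgeEnergy (hf : G.MemH1 f) : Summable (G.edgeEnergy f) :=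
  (memH1_iff.1 hf).2.2.of_nonneg_of_le (edgeEnergy_nonneg f)
    fun e => le_add_of_nonneg_left (edgeMass_nonneg f e)

theorem edgeMass_le (hf : G.MemH1 f) (e : G.E) : G.edgeMass f e ≤ G.l2normSq f := by
  rw [l2normSq_eq_tsum]
  exact hf.summable_edgeMass.le_tsum e fun _ _ => edgeMass_nonneg _ _

theorem edgeEnergy_le (hf : G.MemH1 f) (e : G.E) : G.edgeEnergy f e ≤ G.derivNormSq f := by
  rw [derivNormSq_eq_tsum]
  exact hf.summable_edgeEnergy.le_tsum e fun _ _ => edgeEnergy_nonneg _ _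

theorem integrableOn_sq (hf : G.MemH1 f) (e : G.E) :
    IntegrableOn (fun t => f (G.edgeMap e t) ^ 2) (Ioo 0 (G.len e)) :=
  ((((hf.isEdgeH1 e).continuousOn (G.len_pos e).le).pow 2).integrableOn_Icc).mono_set
    Ioo_subset_Icc_self

theorem edgeMass_add_le (hf : G.MemH1 f) (hg : G.MemH1 g) (e : G.E) :
    G.edgeMass (f + g) e ≤ 2 * G.edgeMass f e + 2 * G.edgeMass g e := by
  unfold edgeMass
  rw [← integral_const_mul, ← integral_const_mul, ← integral_add
    ((hf.integrableOn_sq e).const_mul 2) ((hg.integrableOn_sq e).const_mul 2)]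
  refine integral_mono_of_nonneg (Eventually.of_forall fun _ => sq_nonneg _)
    (((hf.integrableOn_sq e).const_mul 2).add ((hg.integrableOn_sq e).const_mul 2))
    (Eventually.of_forall fun t => ?_)
  simp only [Pi.add_apply]
  nlinarith [sq_nonneg (f (G.edgeMap e t) - g (G.edgeMap e t))]

theorem edgeEnergy_add_le (hf : G.MemH1 f) (hg : G.MemH1 g) (e : G.E) :
    G.edgeEnergy (f + g) e ≤ 2 * G.edgeEnergy f e + 2 * G.edgeEnergy g e :=
  IsEdgeH1.integral_sq_deriv_add_le (G.len_pos e).le (hf.isEdgeH1 e) (hg.isEdgeH1 e)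

theorem add (hf : G.MemH1 f) (hg : G.MemH1 g) : G.MemH1 (f + g) := by
  refine memH1_iff.2 ⟨hf.1.add hg.1,
    fun e => (hf.isEdgeH1 e).add (G.len_pos e).le (hg.isEdgeH1 e), ?_⟩
  refine Summable.add ?_ ?_
  · exact ((hf.summable_edgeMass.mul_left 2).add
      (hg.summable_edgeMass.mul_left 2)).of_nonneg_of_le (edgeMass_nonneg _)
      (hf.edgeMass_add_le hg)
  · exact ((hf.summable_edgeEnergy.mul_left 2).add
      (hg.summable_edgeEnergy.mul_left 2)).of_nonneg_of_le (edgeEnergy_nonneg _)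
      (hf.edgeEnergy_add_le hg)

theorem derivNormSq_add_le (hf : G.MemH1 f) (hg : G.MemH1 g) :
    G.derivNormSq (f + g) ≤ 2 * G.derivNormSq f + 2 * G.derivNormSq g := by
  simp only [derivNormSq_eq_tsum, ← tsum_mul_left]
  rw [← (hf.summable_edgeEnergy.mul_left 2).tsum_add (hg.summable_edgeEnergy.mul_left 2)]
  exact (hf.add hg).summable_edgeEnergy.tsum_le_tsum (hf.edgeEnergy_add_le hg)
    ((hf.summable_edgeEnergy.mul_left 2).add (hg.summable_edgeEnergy.mul_left 2))

theorem edgeEnergy_smul (f : X → ℝ) (c : ℝ) (e : G.E) :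
    G.edgeEnergy (c • f) e = c ^ 2 * G.edgeEnergy f e := by
  have : (c • f) ∘ G.edgeMap e = fun t => c * (f ∘ G.edgeMap e) t := rfl
  simp only [edgeEnergy, edgeDeriv, this, deriv_const_mul_field, mul_pow, integral_const_mul]

theorem edgeMass_smul (f : X → ℝ) (c : ℝ) (e : G.E) :
    G.edgeMass (c • f) e = c ^ 2 * G.edgeMass f e := by
  simp only [edgeMass, Pi.smul_apply, smul_eq_mul, mul_pow, integral_const_mul]

theorem const_smul (hf : G.MemH1 f) (c : ℝ) : G.MemH1 (c • f) := by
  refine memH1_iff.2 ⟨hf.1.const_smul c, fun e => (hf.isEdgeH1 e).const_mul c, ?_⟩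
  simp only [edgeMass_smul, edgeEnergy_smul]
  exact (hf.summable_edgeMass.mul_left _).add (hf.summable_edgeEnergy.mul_left _)

theorem derivNormSq_neg (f : X → ℝ) : G.derivNormSq (-f) = G.derivNormSq f := by
  simp only [derivNormSq_eq_tsum, ← neg_one_smul ℝ f, edgeEnergy_smul]
  norm_num

theorem neg (hf : G.MemH1 f) : G.MemH1 (-f) := by
  simpa using hf.const_smul (-1)

theorem sub (hf : G.MemH1 f) (hg : G.MemH1 g) : G.MemH1 (f - g) := by
  rw [sub_eq_add_neg]
  exact hf.add hg.neg

theorem derivNormSq_sub_le (hf : G.MemH1 f) (hg : G.MemH1 g) :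
    G.derivNormSq (f - g) ≤ 2 * G.derivNormSq f + 2 * G.derivNormSq g := by
  rw [sub_eq_add_neg, ← derivNormSq_neg g]
  exact hf.derivNormSq_add_le hg.neg

theorem zero : G.MemH1 (0 : X → ℝ) := by
  refine memH1_iff.2 ⟨continuous_const, fun e => ?_, ?_⟩
  · exact IsEdgeH1.of_lipschitzOnWith (G.len_pos e).le (LipschitzWith.const 0).lipschitzOnWith
  · have h (e : G.E) : G.edgeMass (0 : X → ℝ) e + G.edgeEnergy (0 : X → ℝ) e = 0 := by
      have hz : (0 : X → ℝ) = (0 : ℝ) • (0 : X → ℝ) := by simp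
      rw [hz, edgeMass_smul, edgeEnergy_smul]
      simp
    simp only [h]
    exact summable_zero

theorem sum_smul {ι : Type*} (s : Finset ι) (c : ι → ℝ) {φ : ι → X → ℝ}
    (hφ : ∀ i, G.MemH1 (φ i)) : G.MemH1 (∑ i ∈ s, c i • φ i) :=
  Finset.sum_induction _ G.MemH1 (fun _ _ => add) zero fun i _ => (hφ i).const_smul (c i)

theorem sq_sub_le (hf : G.MemH1 f) (e : G.E) {s t : ℝ} (hs : s ∈ Icc 0 (G.len e))
    (ht : t ∈ Icc 0 (G.len e)) :
    (f (G.edgeMap e t) - f (G.edgeMap e s)) ^ 2 ≤ G.len e * G.edgeEnergy f e := by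
  wlog hst : s ≤ t generalizing s t
  · rw [← neg_sub, neg_sq]
    exact this ht hs (le_of_not_ge hst)
  refine ((hf.isEdgeH1 e).sq_sub_le (G.len_pos e).le hs.1 hst ht.2).trans ?_
  exact mul_le_mul_of_nonneg_right (by linarith [hs.1, ht.2]) (edgeEnergy_nonneg f e)

theorem len_mul_sq_le (hf : G.MemH1 f) (e : G.E) {t : ℝ} (ht : t ∈ Icc 0 (G.len e)) :
    G.len e * f (G.edgeMap e t) ^ 2 ≤
      2 * G.edgeMass f e + 2 * G.len e ^ 2 * G.edgeEnergy f e := by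
  have hle := (G.len_pos e).le
  have key : ∀ s ∈ Ioo 0 (G.len e), f (G.edgeMap e t) ^ 2 ≤
      2 * f (G.edgeMap e s) ^ 2 + 2 * (G.len e * G.edgeEnergy f e) := by
    intro s hs
    have := hf.sq_sub_le e (Ioo_subset_Icc_self hs) ht
    nlinarith [sq_nonneg (f (G.edgeMap e t) - 2 * f (G.edgeMap e s))]
  have hi := (hf.integrableOn_sq e).const_mul 2
  have := setIntegral_mono_on (by simp) (hi.add (integrable_const _)) measurableSet_Ioo key
  rw [integral_add' hi (integrable_const _), integral_const_mul] at this
  simp only [integral_const, MeasurableSet.univ, measureReal_restrict_apply, univ_inter,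
    Real.volume_real_Ioo_of_le hle, smul_eq_mul, sub_zero] at this
  refine this.trans (le_of_eq ?_)
  unfold edgeMass
  ring

theorem sq_apply_le (x : X) : ∃ C : ℝ, ∀ f, G.MemH1 f → f x ^ 2 ≤ C * G.h1normSq f := by
  obtain ⟨e, t, ht, rfl⟩ := G.cover x
  have hpos := G.len_pos e
  refine ⟨(2 + 2 * G.len e ^ 2) / G.len e, fun f hf => ?_⟩
  rw [div_mul_eq_mul_div, le_div_iff₀ hpos]
  have h1 := hf.len_mul_sq_le e ht
  have h2 := hf.edgeMass_le e
  have h3 := hf.edgeEnergy_le e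
  have h4 := G.derivNormSq_nonneg f
  have h5 := G.l2normSq_nonneg f
  unfold h1normSq
  nlinarith [mul_le_mul_of_nonneg_left h3 (sq_nonneg (G.len e)),
    mul_nonneg (sq_nonneg (G.len e)) h5]

theorem eq_zero_of_l2normSq_eq_zero (hf : G.MemH1 f) (h : G.l2normSq f = 0) (x : X) :
    f x = 0 := by
  obtain ⟨e, t, ht, rfl⟩ := G.cover x
  have hpos := G.len_pos e
  have hm : G.edgeMass f e = 0 := le_antisymm (h ▸ hf.edgeMass_le e) (edgeMass_nonneg _ _)
  have hcont := (hf.isEdgeH1 e).continuousOn hpos.le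
  have hIoo : EqOn (f ∘ G.edgeMap e) 0 (Ioo 0 (G.len e)) := by
    have hae := (setIntegral_eq_zero_iff_of_nonneg_ae
      (Eventually.of_forall fun _ => sq_nonneg _) (hf.integrableOn_sq e)).1 hm
    refine Measure.eqOn_Ioo_of_ae_eq volume ?_ (hcont.mono Ioo_subset_Icc_self) continuousOn_const
    filter_upwards [hae] with s hs
    exact pow_eq_zero_iff (two_ne_zero) |>.1 hs
  have := hIoo.of_subset_closure hcont (continuousOn_const (c := (0 : ℝ))) Ioo_subset_Icc_self
    (by rw [closure_Ioo hpos.ne])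
  exact this ht

end MemH1

/-- The `L²` norm on `H¹(G)` is controlled, up to an arbitrarily small multiple of the energy,
by finitely many point evaluations. -/
def PointControlled (G : MetricGraphOn X) : Prop :=
  ∀ ε : ℝ, 0 < ε → ∃ (S : Finset X) (C : ℝ), 0 ≤ C ∧ ∀ f, G.MemH1 f →
    G.l2normSq f ≤ ε * G.derivNormSq f + C * ∑ x ∈ S, f x ^ 2

namespace PointControlled

theorem exists_subseq_tendsto {D : Set X} (hD : D.Countable) {u : ℕ → X → ℝ}
    (hu : ∀ n, G.MemH1 (u n)) (hb : ∀ n, G.h1normSq (u n) ≤ 1) :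
    ∃ (a : X → ℝ) (φ : ℕ → ℕ), StrictMono φ ∧
      ∀ x ∈ D, Tendsto (fun n => u (φ n) x) atTop (nhds (a x)) := by
  have : Countable D := hD.to_subtype
  choose C hC using fun x => MemH1.sq_apply_le (G := G) x
  have hmem (n : ℕ) : (fun x : D => u n x) ∈
      Set.pi univ fun x : D => Icc (-√|C x|) (√|C x|) := by
    intro x _
    rw [mem_Icc, ← abs_le]
    apply Real.abs_le_sqrt
    have h0 : 0 ≤ G.h1normSq (u n) := add_nonneg (l2normSq_nonneg _) (derivNormSq_nonneg _)
    refine (hC x _ (hu n)).trans ((mul_le_mul_of_nonneg_right (le_abs_self _) h0).trans ?_)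
    exact mul_le_of_le_one_right (abs_nonneg _) (hb n)
  obtain ⟨a, -, φ, hφ, ha⟩ :=
    (isCompact_univ_pi fun x : D => isCompact_Icc).tendsto_subseq hmem
  classical
  refine ⟨fun x => if h : x ∈ D then a ⟨x, h⟩ else 0, φ, hφ, fun x hx => ?_⟩
  simpa [hx] using (tendsto_pi_nhds.1 ha) ⟨x, hx⟩

theorem compactlyEmbedded (hG : G.PointControlled) : G.CompactlyEmbedded {f | G.MemH1 f} := by
  intro u hu hb
  choose S C hC0 hC using fun j : ℕ => hG (1 / (j + 1)) (by positivity)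
  obtain ⟨a, φ, hφ, ha⟩ := exists_subseq_tendsto
    (countable_iUnion fun j => (S j).countable_toSet) hu hb
  refine ⟨φ, hφ, fun ε hε => ?_⟩
  obtain ⟨j, hj⟩ := exists_nat_one_div_lt (show (0 : ℝ) < ε / 8 by positivity)
  have hlim : Tendsto (fun p : ℕ × ℕ => C j * ∑ x ∈ S j, (u (φ p.1) x - u (φ p.2) x) ^ 2)
      (atTop ×ˢ atTop) (nhds (C j * ∑ x ∈ S j, (a x - a x) ^ 2)) := by
    refine (tendsto_finsetSum _ fun x hx => ?_).const_mul _
    have hx' := ha x (mem_iUnion.2 ⟨j, hx⟩)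
    exact ((hx'.comp tendsto_fst).sub (hx'.comp tendsto_snd)).pow 2
  simp only [sub_self, ne_eq, OfNat.ofNat_ne_zero, not_false_eq_true, zero_pow,
    Finset.sum_const_zero, mul_zero, prod_atTop_atTop_eq] at hlim
  obtain ⟨⟨N₁, N₂⟩, hN⟩ := eventually_atTop.1
    (hlim.eventually (gt_mem_nhds (show (0 : ℝ) < ε / 2 by positivity)))
  refine ⟨max N₁ N₂, fun m hm n hn => ?_⟩
  have h1 := hN (m, n) ⟨le_of_max_le_left hm, le_of_max_le_right hn⟩
  have h2 := hC j _ ((hu (φ m)).sub (hu (φ n)))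
  have h3 := (hu (φ m)).derivNormSq_sub_le (hu (φ n))
  have h4 (n : ℕ) : G.derivNormSq (u n) ≤ 1 :=
    (le_add_of_nonneg_left (l2normSq_nonneg _)).trans (hb n)
  have h5 : G.derivNormSq (u (φ m) - u (φ n)) ≤ 4 := by linarith [h4 (φ m), h4 (φ n)]
  have h6 := mul_le_mul hj.le h5 (derivNormSq_nonneg _) (by positivity)
  simp only [Pi.sub_apply] at h2
  linarith

theorem le_of_forall_le {M : ℝ} {S : Finset X} {C : ℝ}
    (hS : ∀ f, G.MemH1 f →
      G.l2normSq f ≤ 1 / (2 * (|M| + 1)) * G.derivNormSq f + C * ∑ x ∈ S, f x ^ 2)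
    {k : ℕ} (hk : S.card < k) {φ : Fin k → X → ℝ} (hφ : ∀ i, G.MemH1 (φ i))
    (hli : LinearIndependent ℝ (fun i => (G.subgraphSet univ).domRestrict (φ i))) {μ : ℝ}
    (hμ : ∀ c : Fin k → ℝ, G.derivNormSq (∑ i, c i • φ i) ≤ μ * G.l2normSq (∑ i, c i • φ i)) :
    M ≤ μ := by
  by_contra! hlt
  obtain ⟨c, hc0, hc⟩ := exists_sum_smul_eq_zero_of_card_lt hk φ
  set F := ∑ i, c i • φ i with hF
  have hFm : G.MemH1 F := MemH1.sum_smul _ c hφ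
  have h1 := hS F hFm
  rw [Finset.sum_eq_zero fun x hx => by rw [hc x hx, sq, zero_mul], mul_zero, add_zero] at h1
  have h0 := G.l2normSq_nonneg F
  have hpos : 0 < 2 * (|M| + 1) := by positivity
  rw [one_div, ← div_eq_inv_mul, le_div_iff₀ hpos] at h1
  have h2 : μ * G.l2normSq F ≤ |M| * G.l2normSq F :=
    mul_le_mul_of_nonneg_right (hlt.le.trans (le_abs_self M)) h0
  have h3 : G.l2normSq F = 0 := by
    nlinarith [hμ c, mul_nonneg (abs_nonneg M) h0]
  have hz : ∀ x, F x = 0 := hFm.eq_zero_of_l2normSq_eq_zero h3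
  refine hc0 (funext fun i => Fintype.linearIndependent_iff.1 hli c ?_ i)
  ext x
  simpa [hF] using hz x

theorem hasPurelyDiscreteSpectrumOn (hG : G.PointControlled)
    (hne : ∀ k : ℕ, ∃ μ : ℝ, ∃ φ : Fin k → X → ℝ, (∀ i, G.MemH1 (φ i)) ∧
      LinearIndependent ℝ (fun i => (G.subgraphSet univ).domRestrict (φ i)) ∧
      ∀ c : Fin k → ℝ, G.derivNormSq (∑ i, c i • φ i) ≤ μ * G.l2normSq (∑ i, c i • φ i)) :
    G.HasPurelyDiscreteSpectrumOn {f | G.MemH1 f} := by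
  refine tendsto_atTop.2 fun M => ?_
  obtain ⟨S, C, -, hS⟩ := hG (1 / (2 * (|M| + 1))) (by positivity)
  filter_upwards [eventually_gt_atTop S.card] with k hk
  refine le_csInf (hne k) ?_
  rintro μ ⟨φ, hφ, hli, hμ⟩
  exact le_of_forall_le hS hk hφ hli hμ

theorem of_weights (a : G.E → ℝ) (ha : ∀ e, 0 ≤ a e) (hlen : Tendsto G.len cofinite (nhds 0))
    (hsum : Summable fun e => G.len e * a e) (x₀ : X)
    (hf : ∀ f, G.MemH1 f → ∀ e,
      f (G.edgeMap e 0) ^ 2 ≤ a e * (G.derivNormSq f + f x₀ ^ 2)) : G.PointControlled := by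
  classical
  intro ε hε
  have hpos := G.len_pos
  have hlen2 : ∀ᶠ e in cofinite, 2 * G.len e ^ 2 < ε / 2 := by
    have : Tendsto (fun e => 2 * G.len e ^ 2) cofinite (nhds (2 * 0 ^ 2)) :=
      (hlen.pow 2).const_mul 2
    rw [zero_pow two_ne_zero, mul_zero] at this
    exact this.eventually (gt_mem_nhds (by positivity))
  have hsum2 : Summable fun e => 2 * (G.len e * a e) := hsum.mul_left 2
  obtain ⟨F, hF1, hF2⟩ : ∃ F : Finset G.E, (∀ e ∉ F, 2 * G.len e ^ 2 ≤ ε / 2) ∧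
      ∑' e, (F : Set G.E)ᶜ.indicator (fun e => 2 * (G.len e * a e)) e ≤ ε / 2 := by
    have h1 : ∀ᶠ F : Finset G.E in atTop, ∀ e ∉ F, 2 * G.len e ^ 2 ≤ ε / 2 := by
      filter_upwards [eventually_ge_atTop (Filter.eventually_cofinite.1 hlen2).toFinset]
        with F hF e he
      by_contra! h
      exact he (hF (by simpa using h.le))
    have h2 := (tendsto_tsum_compl_atTop_zero fun e => 2 * (G.len e * a e)).eventually
      (gt_mem_nhds (show (0 : ℝ) < ε / 2 by positivity))
    obtain ⟨F, hF1, hF2⟩ := (h1.and h2).exists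
    refine ⟨F, hF1, ?_⟩
    rw [← tsum_subtype]
    exact hF2.le
  have hm (e : G.E) : ∃ m : ℕ, 0 < m ∧ 2 * G.len e ^ 2 / m ≤ ε / 2 := by
    obtain ⟨m, hm⟩ := exists_nat_gt (2 * G.len e ^ 2 / (ε / 2))
    have hm0 : (0 : ℝ) < m := lt_of_le_of_lt (by positivity) hm
    refine ⟨m, by exact_mod_cast hm0, ?_⟩
    rw [div_lt_iff₀ (by positivity)] at hm
    rw [div_le_iff₀ hm0]
    linarith
  choose m hm0 hm using hm
  let S : Finset X := insert x₀ (F.biUnion fun e =>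
    (Finset.range (m e)).image fun j : ℕ => G.edgeMap e (j * (G.len e / m e)))
  let K : G.E → ℝ := fun e => if e ∈ F then 2 * G.len e * m e else 0
  have hK : HasSum K (∑ e ∈ F, K e) := hasSum_sum_of_ne_finset_zero fun e he => if_neg he
  refine ⟨S, ∑ e ∈ F, K e + ε / 2, ?_, fun f hfm => ?_⟩
  · refine add_nonneg (Finset.sum_nonneg fun e he => ?_) (by positivity)
    simp only [K, if_pos he]
    have := hpos e
    positivity
  set T := ∑ x ∈ S, f x ^ 2
  have hT (x : X) (hx : x ∈ S) : f x ^ 2 ≤ T :=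
    Finset.single_le_sum (f := fun x => f x ^ 2) (fun _ _ => sq_nonneg _) hx
  have hT0 : f x₀ ^ 2 ≤ T := hT x₀ (Finset.mem_insert_self _ _)
  have hTn : 0 ≤ T := (sq_nonneg _).trans hT0
  set D := G.derivNormSq f with hD
  have hDn : 0 ≤ D := derivNormSq_nonneg f
  have hedge (e : G.E) : G.edgeMass f e ≤ ε / 2 * G.edgeEnergy f e + K e * T +
      (F : Set G.E)ᶜ.indicator (fun e => 2 * (G.len e * a e)) e * (D + T) := by
    have hl := hpos e
    by_cases he : e ∈ F
    · have h1 := (hfm.isEdgeH1 e).integral_sq_le hl (hm0 e)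
      have h2 : ∑ j ∈ Finset.range (m e), (f ∘ G.edgeMap e) (j * (G.len e / m e)) ^ 2 ≤
          m e * T := by
        refine (Finset.sum_le_card_nsmul _ _ T fun j hj => hT _ ?_).trans (by simp)
        exact Finset.mem_insert_of_mem
          (Finset.mem_biUnion.2 ⟨e, he, Finset.mem_image_of_mem _ hj⟩)
      have h3 := mul_le_mul_of_nonneg_right (hm e) (edgeEnergy_nonneg f e)
      have h4 := mul_le_mul_of_nonneg_left h2 (show 0 ≤ 2 * G.len e by positivity)
      simp only [K, if_pos he, indicator, mem_compl_iff, Finset.mem_coe, he, not_true_eq_false,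
        if_false]
      refine h1.trans ((add_le_add h3 h4).trans (le_of_eq (by ring)))
    · have h1 := (hfm.isEdgeH1 e).integral_sq_le hl one_pos
      have h3 := mul_le_mul_of_nonneg_right (hF1 e he) (edgeEnergy_nonneg f e)
      have h4 : f (G.edgeMap e 0) ^ 2 ≤ a e * (D + T) :=
        (hf f hfm e).trans (mul_le_mul_of_nonneg_left (by linarith) (ha e))
      have h5 := mul_le_mul_of_nonneg_left h4 (show 0 ≤ 2 * G.len e by positivity)
      simp only [K, if_neg he, indicator, mem_compl_iff, Finset.mem_coe, he, not_false_eq_true,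
        if_true]
      simp only [Nat.cast_one, div_one, Finset.range_one, Finset.sum_singleton, Nat.cast_zero,
        zero_mul, Function.comp_apply] at h1
      refine h1.trans ((add_le_add h3 h5).trans (le_of_eq (by ring)))
  have hE : HasSum (fun e => ε / 2 * G.edgeEnergy f e) (ε / 2 * D) := by
    rw [hD, derivNormSq_eq_tsum]
    exact hfm.summable_edgeEnergy.hasSum.mul_left _
  have htot := hasSum_le hedge hfm.summable_edgeMass.hasSum
    ((hE.add (hK.mul_right T)).add
      ((hsum2.indicator (F : Set G.E)ᶜ).hasSum.mul_right (D + T)))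
  rw [l2normSq_eq_tsum]
  refine htot.trans ?_
  have := mul_le_mul_of_nonneg_right hF2 (add_nonneg hDn hTn)
  refine (add_le_add_right this _).trans (le_of_eq (by ring))

end PointControlled

/-- The tent function of height and radius `r` centred at `p`. -/
noncomputable def tent (r : ℝ) (p x : X) : ℝ := max 0 (r - dist x p)

theorem tent_of_le {r : ℝ} {p x : X} (h : r ≤ dist x p) : tent r p x = 0 :=
  max_eq_left (sub_nonpos.2 h)

theorem lipschitzWith_tent (r : ℝ) (p : X) : LipschitzWith 1 (tent r p) := by
  have h : LipschitzWith 1 fun x => r - dist x p := by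
    simpa using (LipschitzWith.const r).sub (LipschitzWith.dist_left p)
  exact h.const_max 0

theorem lipschitzOnWith_edgeMap (e : G.E) :
    LipschitzOnWith 1 (G.edgeMap e) (Icc 0 (G.len e)) :=
  LipschitzOnWith.of_dist_le_mul fun s hs t ht => by
    simpa [Real.dist_eq] using G.dist_le e s hs t ht

theorem edgeEnergy_le_of_lipschitzWith {K : NNReal} {f : X → ℝ} (hf : LipschitzWith K f)
    (e : G.E) : G.edgeEnergy f e ≤ K ^ 2 * G.len e := by
  have hl := (G.len_pos e).le
  have hlip : LipschitzOnWith K (f ∘ G.edgeMap e) (Icc 0 (G.len e)) := by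
    simpa using hf.comp_lipschitzOnWith (lipschitzOnWith_edgeMap e)
  have hbd : ∀ t ∈ Ioo 0 (G.len e), G.edgeDeriv f e t ^ 2 ≤ (K : ℝ) ^ 2 := fun t ht => by
    rw [← sq_abs]
    have := norm_deriv_le_of_lipschitzOn (Icc_mem_nhds ht.1 ht.2) hlip
    rw [Real.norm_eq_abs] at this
    unfold edgeDeriv
    gcongr
  have h := setIntegral_mono_on (IsEdgeH1.of_lipschitzOnWith hl hlip).2
    (show IntegrableOn (fun _ => (K : ℝ) ^ 2) (Ioo 0 (G.len e)) by simp) measurableSet_Ioo hbd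
  refine h.trans (le_of_eq ?_)
  simp [hl, mul_comm]

theorem edgeMass_eq_zero {f : X → ℝ} {e : G.E}
    (h : ∀ t ∈ Icc 0 (G.len e), f (G.edgeMap e t) = 0) : G.edgeMass f e = 0 := by
  refine setIntegral_eq_zero_of_forall_eq_zero fun t ht => ?_
  rw [h t (Ioo_subset_Icc_self ht), sq, zero_mul]

theorem edgeEnergy_eq_zero {f : X → ℝ} {e : G.E}
    (h : ∀ t ∈ Icc 0 (G.len e), f (G.edgeMap e t) = 0) : G.edgeEnergy f e = 0 := by
  refine setIntegral_eq_zero_of_forall_eq_zero fun t ht => ?_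
  have hev : f ∘ G.edgeMap e =ᶠ[nhds t] fun _ => (0 : ℝ) := by
    filter_upwards [Icc_mem_nhds ht.1 ht.2] with s hs using h s hs
  rw [edgeDeriv, hev.deriv_eq, deriv_const, sq, zero_mul]

theorem memH1_of_lipschitzWith {K : NNReal} {f : X → ℝ} (hf : LipschitzWith K f)
    {F : Finset G.E} (hF : ∀ e ∉ F, ∀ t ∈ Icc 0 (G.len e), f (G.edgeMap e t) = 0) :
    G.MemH1 f := by
  refine memH1_iff.2 ⟨hf.continuous, fun e => ?_, ?_⟩
  · exact IsEdgeH1.of_lipschitzOnWith (G.len_pos e).le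
      (hf.comp_lipschitzOnWith (lipschitzOnWith_edgeMap e))
  · refine summable_of_ne_finset_zero (s := F) fun e he => ?_
    rw [edgeMass_eq_zero (hF e he), edgeEnergy_eq_zero (hF e he), add_zero]

theorem derivNormSq_le_of_lipschitzWith {K : NNReal} {f : X → ℝ} (hf : LipschitzWith K f)
    {F : Finset G.E} (hF : ∀ e ∉ F, ∀ t ∈ Icc 0 (G.len e), f (G.edgeMap e t) = 0) :
    G.derivNormSq f ≤ K ^ 2 * ∑ e ∈ F, G.len e := by
  rw [derivNormSq_eq_tsum, tsum_eq_sum fun e he => edgeEnergy_eq_zero (hF e he),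
    Finset.mul_sum]
  exact Finset.sum_le_sum fun e _ => edgeEnergy_le_of_lipschitzWith hf e

theorem l2normSq_mono_of_sq_le {f g : X → ℝ} (hf : G.MemH1 f) (hg : G.MemH1 g)
    (h : ∀ x, f x ^ 2 ≤ g x ^ 2) : G.l2normSq f ≤ G.l2normSq g := by
  rw [l2normSq_eq_tsum, l2normSq_eq_tsum]
  refine hf.summable_edgeMass.tsum_le_tsum (fun e => ?_) hg.summable_edgeMass
  exact integral_mono (hf.integrableOn_sq e) (hg.integrableOn_sq e) fun t => h _

theorem l2normSq_smul (f : X → ℝ) (c : ℝ) : G.l2normSq (c • f) = c ^ 2 * G.l2normSq f := by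
  simp only [l2normSq_eq_tsum, MemH1.edgeMass_smul, tsum_mul_left]

theorem lipschitzWith_sum_smul_tent {k : ℕ} (r : ℝ) (p : Fin k → X) (c : Fin k → ℝ) :
    LipschitzWith (∑ i, ‖c i‖₊) (∑ i, c i • tent r (p i)) := by
  refine LipschitzWith.of_dist_le_mul fun x y => ?_
  simp only [Finset.sum_apply, Pi.smul_apply, smul_eq_mul, Real.dist_eq, NNReal.coe_sum,
    coe_nnnorm, Real.norm_eq_abs, ← Finset.sum_sub_distrib, ← mul_sub, Finset.sum_mul]
  refine (Finset.abs_sum_le_sum_abs _ _).trans (Finset.sum_le_sum fun i _ => ?_)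
  rw [abs_mul]
  have := (lipschitzWith_tent r (p i)).dist_le_mul x y
  rw [Real.dist_eq, NNReal.coe_one, one_mul] at this
  gcongr

theorem exists_linearIndependent_of_separated {k : ℕ} {r : ℝ} (hr : 0 < r) {p : Fin k → X}
    (hp : ∀ i j, i ≠ j → 2 * r ≤ dist (p i) (p j)) {F : Finset G.E}
    (hF : ∀ i, ∀ e ∉ F, ∀ t ∈ Icc 0 (G.len e), r ≤ dist (G.edgeMap e t) (p i)) :
    ∃ μ : ℝ, ∃ φ : Fin k → X → ℝ, (∀ i, G.MemH1 (φ i)) ∧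
      LinearIndependent ℝ (fun i => (G.subgraphSet univ).domRestrict (φ i)) ∧
      ∀ c : Fin k → ℝ, G.derivNormSq (∑ i, c i • φ i) ≤ μ * G.l2normSq (∑ i, c i • φ i) := by
  set φ : Fin k → X → ℝ := fun i => tent r (p i) with hφ
  have hφF (i : Fin k) : ∀ e ∉ F, ∀ t ∈ Icc 0 (G.len e), φ i (G.edgeMap e t) = 0 :=
    fun e he t ht => tent_of_le (hF i e he t ht)
  have hφm (i : Fin k) : G.MemH1 (φ i) :=
    memH1_of_lipschitzWith (lipschitzWith_tent r (p i)) (hφF i)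
  have hdisj (x : X) (i j : Fin k) (hij : i ≠ j) (hi : φ i x ≠ 0) : φ j x = 0 := by
    refine tent_of_le ?_
    have h1 : dist x (p i) < r := by
      by_contra! h
      exact hi (tent_of_le h)
    have := hp i j hij
    have := dist_triangle_left (p i) (p j) x
    linarith
  have happ (c : Fin k → ℝ) (x : X) (i : Fin k) (hi : φ i x ≠ 0) :
      (∑ j, c j • φ j) x = c i * φ i x := by
    simp only [Finset.sum_apply, Pi.smul_apply, smul_eq_mul]
    exact Finset.sum_eq_single i (fun j _ hj => by rw [hdisj x i j hj.symm hi, mul_zero])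
      (by simp)
  have hpi (i : Fin k) : φ i (p i) ≠ 0 := by simp [hφ, tent, hr.le, hr.ne']
  have hmpos (i : Fin k) : 0 < G.l2normSq (φ i) :=
    (l2normSq_nonneg _).lt_of_ne' fun h => hpi i ((hφm i).eq_zero_of_l2normSq_eq_zero h _)
  refine ⟨k * (∑ e ∈ F, G.len e) * ∑ i, (G.l2normSq (φ i))⁻¹, φ, hφm, ?_, fun c => ?_⟩
  · refine Fintype.linearIndependent_iff.2 fun c hc i => ?_
    have hmem : p i ∈ G.subgraphSet univ := by
      obtain ⟨e, t, ht, h⟩ := G.cover (p i)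
      exact mem_biUnion (mem_univ e) ⟨t, ht, h⟩
    have h1 := congrFun hc ⟨p i, hmem⟩
    have h2 := happ c (p i) i (hpi i)
    simp only [Finset.sum_apply, Pi.smul_apply, domRestrict_apply, Pi.zero_apply] at h1 h2
    rw [h1] at h2
    exact (mul_eq_zero.1 h2.symm).resolve_right (hpi i)
  · set f := ∑ i, c i • φ i with hf
    have hfm : G.MemH1 f := MemH1.sum_smul _ c hφm
    have hL : 0 ≤ ∑ e ∈ F, G.len e := Finset.sum_nonneg fun e _ => (G.len_pos e).le
    have h1 : G.derivNormSq f ≤ (∑ i, |c i|) ^ 2 * ∑ e ∈ F, G.len e := by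
      have := derivNormSq_le_of_lipschitzWith (G := G) (lipschitzWith_sum_smul_tent r p c)
        (F := F) fun e he t ht => by
          simp only [Finset.sum_apply, Pi.smul_apply]
          exact Finset.sum_eq_zero fun i _ => by rw [tent_of_le (hF i e he t ht), smul_zero]
      simpa using this
    have h2 : (∑ i, |c i|) ^ 2 ≤ k * ∑ i, c i ^ 2 := by
      simpa using sq_sum_le_card_mul_sum_sq (s := Finset.univ) (f := fun i => |c i|)
    have h3 : ∑ i, c i ^ 2 ≤ (∑ i, (G.l2normSq (φ i))⁻¹) * G.l2normSq f := by
      rw [Finset.sum_mul]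
      refine Finset.sum_le_sum fun i _ => ?_
      rw [← div_eq_inv_mul, le_div_iff₀ (hmpos i), ← l2normSq_smul]
      refine l2normSq_mono_of_sq_le ((hφm i).const_smul _) hfm fun x => ?_
      by_cases hx : φ i x = 0
      · simp [hx, sq_nonneg]
      · rw [hf, happ c x i hx, Pi.smul_apply, smul_eq_mul]
    calc G.derivNormSq f ≤ (∑ i, |c i|) ^ 2 * ∑ e ∈ F, G.len e := h1
      _ ≤ (k * ((∑ i, (G.l2normSq (φ i))⁻¹) * G.l2normSq f)) * ∑ e ∈ F, G.len e := by
        gcongr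
        exact h2.trans (by gcongr)
      _ = _ := by ring

theorem exists_linearIndependent (hlen : Tendsto G.len cofinite (nhds 0)) {p : ℕ → X}
    (hp : Function.Injective p)
    (hsep : ∀ i, ∃ r > 0, ∀ᶠ e in cofinite, r ≤ dist (G.edgeMap e 0) (p i)) (k : ℕ) :
    ∃ μ : ℝ, ∃ φ : Fin k → X → ℝ, (∀ i, G.MemH1 (φ i)) ∧
      LinearIndependent ℝ (fun i => (G.subgraphSet univ).domRestrict (φ i)) ∧
      ∀ c : Fin k → ℝ, G.derivNormSq (∑ i, c i • φ i) ≤ μ * G.l2normSq (∑ i, c i • φ i) := by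
  have hsmall {d : ℝ} (hd : 0 < d) : ∀ᶠ r : ℝ in nhdsWithin 0 (Ioi 0), 2 * r ≤ d := by
    filter_upwards [Ioo_mem_nhdsGT (half_pos hd)] with r hr
    linarith [hr.2]
  have h1 : ∀ᶠ r : ℝ in nhdsWithin 0 (Ioi 0), ∀ i j : Fin k, i ≠ j →
      2 * r ≤ dist (p i) (p j) := by
    refine eventually_all.2 fun i => eventually_all.2 fun j => ?_
    by_cases hij : i = j
    · simp [hij]
    · refine (hsmall (dist_pos.2 fun h => hij (Fin.ext (hp h)))).mono fun r hr _ => hr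
  have h2 : ∀ᶠ r : ℝ in nhdsWithin 0 (Ioi 0), ∀ i : Fin k,
      ∀ᶠ e in cofinite, 2 * r ≤ dist (G.edgeMap e 0) (p i) := by
    refine eventually_all.2 fun i => ?_
    obtain ⟨d, hd, hev⟩ := hsep i
    filter_upwards [hsmall hd] with r hr
    exact hev.mono fun e he => hr.trans he
  obtain ⟨r, hr1, hr2, hr0⟩ := (h1.and (h2.and self_mem_nhdsWithin)).exists
  have hr : 0 < r := hr0
  have hev : ∀ᶠ e in cofinite, G.len e < r ∧ ∀ i : Fin k, 2 * r ≤ dist (G.edgeMap e 0) (p i) :=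
    (hlen.eventually (gt_mem_nhds hr)).and (eventually_all.2 hr2)
  refine exists_linearIndependent_of_separated hr (p := fun i : Fin k => p i) hr1
    (F := (eventually_cofinite.1 hev).toFinset) fun i e he t ht => ?_
  have he' : G.len e < r ∧ ∀ i : Fin k, 2 * r ≤ dist (G.edgeMap e 0) (p i) := by
    simpa using he
  have hd := G.dist_le e 0 ⟨le_rfl, (G.len_pos e).le⟩ t ht
  rw [zero_sub, abs_neg, abs_of_nonneg ht.1] at hd
  have := dist_triangle (G.edgeMap e 0) (G.edgeMap e t) (p i)
  linarith [he'.2 i, he'.1, ht.2]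

end MetricGraphOn

/-- A parametrisation of the edges of `G` as a comb whose `n`-th tooth sits at the shaft vertex
`v n`, located at position `x n`, and has length `x n`. -/
structure CombParam {X : Type} [MetricSpace X] (G : MetricGraphOn X) (x : ℕ → ℝ) where
  edge : (ℕ ⊕ ℕ) ≃ G.E
  v : ℕ → X
  v_injective : Function.Injective v
  len_shaft : ∀ n, G.len (edge (Sum.inl n)) = x n - x (n + 1)
  len_tooth : ∀ n, G.len (edge (Sum.inr n)) = x n
  shaft_zero : ∀ n, G.edgeMap (edge (Sum.inl n)) 0 = v (n + 1)
  shaft_len : ∀ n, G.edgeMap (edge (Sum.inl n)) (G.len (edge (Sum.inl n))) = v n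
  tooth_zero : ∀ n, G.edgeMap (edge (Sum.inr n)) 0 = v n

theorem IsDiagonalComb.nonempty_combParam {X : Type} [MetricSpace X] {G : MetricGraphOn X}
    {α : ℝ} (hG : IsDiagonalComb G α) :
    Nonempty (CombParam G fun n : ℕ => ((n : ℝ) + 1) ^ (-α)) := by
  obtain ⟨eE, eV, h1, h2, h3, h4⟩ := hG
  refine ⟨⟨eE, fun n => G.vertexMap (eV (Sum.inl n)), ?_, fun n => ?_, h2, fun n => ?_,
    fun n => ?_, fun n => ?_⟩⟩
  · exact G.vertexMap_inj.comp (eV.injective.comp Sum.inl_injective)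
  · rw [h1 n]
    push_cast
    ring_nf
  · rw [G.edgeMap_zero, (h3 n).1]
  · rw [G.edgeMap_len, (h3 n).2]
  · rw [G.edgeMap_zero, (h4 n).1]

namespace CombParam

open MetricGraphOn

variable {X : Type} [MetricSpace X] {G : MetricGraphOn X} {x : ℕ → ℝ} (P : CombParam G x)
include P

theorem pos (n : ℕ) : 0 < x n := P.len_tooth n ▸ G.len_pos _

theorem strictAnti : StrictAnti x := strictAnti_nat_of_succ_lt fun n => by
  have := G.len_pos (P.edge (Sum.inl n))
  rw [P.len_shaft] at this
  linarith

theorem eventually_cofinite {p : G.E → Prop} (hl : ∀ᶠ n in atTop, p (P.edge (Sum.inl n)))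
    (hr : ∀ᶠ n in atTop, p (P.edge (Sum.inr n))) : ∀ᶠ e in cofinite, p e := by
  rw [← Nat.cofinite_eq_atTop] at hl hr
  rw [Filter.eventually_cofinite] at hl hr ⊢
  refine ((hl.image (P.edge ∘ Sum.inl)).union (hr.image (P.edge ∘ Sum.inr))).subset ?_
  intro e he
  obtain ⟨n | n, rfl⟩ := P.edge.surjective e
  · exact Or.inl ⟨n, he, rfl⟩
  · exact Or.inr ⟨n, he, rfl⟩

theorem tendsto_len (hx : Tendsto x atTop (nhds 0)) : Tendsto G.len cofinite (nhds 0) := by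
  refine tendsto_order.2 ⟨fun a ha => Eventually.of_forall fun e => ha.trans (G.len_pos e),
    fun a ha => P.eventually_cofinite ?_ ?_⟩
  · filter_upwards [hx.eventually (gt_mem_nhds ha)] with n hn
    rw [P.len_shaft]
    linarith [P.pos (n + 1)]
  · filter_upwards [hx.eventually (gt_mem_nhds ha)] with n hn
    rwa [P.len_tooth]

theorem dist_v_le {m n : ℕ} (hmn : m ≤ n) : dist (P.v m) (P.v n) ≤ x m - x n := by
  induction n, hmn using Nat.le_induction with
  | base => simp
  | succ n _ ih =>
    have hl := (G.len_pos (P.edge (Sum.inl n))).le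
    have h := G.dist_le (P.edge (Sum.inl n)) _ ⟨hl, le_rfl⟩ 0 ⟨le_rfl, hl⟩
    rw [P.shaft_len, P.shaft_zero, sub_zero, abs_of_nonneg hl, P.len_shaft] at h
    linarith [dist_triangle (P.v m) (P.v n) (P.v (n + 1))]

theorem cauchySeq_v (hx : Tendsto x atTop (nhds 0)) : CauchySeq P.v := by
  refine cauchySeq_of_le_tendsto_0' x (fun m n hmn => ?_) hx
  linarith [P.dist_v_le hmn, P.pos n]

theorem exists_shift_not_tendsto : ∃ N, ∀ i, ¬ Tendsto P.v atTop (nhds (P.v (N + i))) := by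
  by_cases h : ∃ m, Tendsto P.v atTop (nhds (P.v m))
  · obtain ⟨m, hm⟩ := h
    refine ⟨m + 1, fun i hi => ?_⟩
    have := P.v_injective (tendsto_nhds_unique hm hi)
    omega
  · push Not at h
    exact ⟨0, fun i => h _⟩

theorem exists_separated (hx : Tendsto x atTop (nhds 0)) {q : X}
    (hq : ¬ Tendsto P.v atTop (nhds q)) :
    ∃ r > 0, ∀ᶠ e in cofinite, r ≤ dist (G.edgeMap e 0) q := by
  have : ∃ r > 0, ∀ᶠ n in atTop, r ≤ dist (P.v n) q := by
    by_contra! hcon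
    refine hq (le_nhds_of_cauchy_adhp (P.cauchySeq_v hx) ?_)
    refine (mapClusterPt_iff_frequently (u := P.v)).2 fun s hs => ?_
    obtain ⟨r, hr, hrs⟩ := Metric.mem_nhds_iff.1 hs
    exact (hcon r hr).mono fun n hn => hrs hn
  obtain ⟨r, hr, hev⟩ := this
  refine ⟨r, hr, P.eventually_cofinite ?_ ?_⟩
  · filter_upwards [(tendsto_add_atTop_nat 1).eventually hev] with n hn
    rwa [P.shaft_zero]
  · filter_upwards [hev] with n hn
    rwa [P.tooth_zero]

variable {f : X → ℝ}

theorem sq_sub_le (hf : G.MemH1 f) {n m : ℕ} (hnm : n ≤ m) :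
    (f (P.v n) - f (P.v m)) ^ 2 ≤ (x n - x m) * G.derivNormSq f := by
  have hE : ∑ k ∈ Finset.Ico n m, G.edgeEnergy f (P.edge (Sum.inl k)) ≤ G.derivNormSq f := by
    rw [derivNormSq_eq_tsum]
    have hinj : Function.Injective fun k => P.edge (Sum.inl k) :=
      P.edge.injective.comp Sum.inl_injective
    have h := hf.summable_edgeEnergy.sum_le_tsum
      ((Finset.Ico n m).map ⟨_, hinj⟩) fun e _ => edgeEnergy_nonneg f e
    simpa using h
  have hL : ∑ k ∈ Finset.Ico n m, G.len (P.edge (Sum.inl k)) = x n - x m := by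
    simp only [P.len_shaft]
    have := Finset.sum_Ico_sub x hnm
    rw [← neg_inj, ← Finset.sum_neg_distrib]
    simpa using this
  have hS : ∑ k ∈ Finset.Ico n m, (f (P.v k) - f (P.v (k + 1))) = f (P.v n) - f (P.v m) := by
    have := Finset.sum_Ico_sub (fun k => f (P.v k)) hnm
    rw [← neg_inj, ← Finset.sum_neg_distrib]
    simpa using this
  rw [← hS, ← hL]
  refine (Finset.sum_sq_le_sum_mul_sum_of_sq_le_mul _ (fun k _ => (G.len_pos _).le)
    (fun k _ => edgeEnergy_nonneg f (P.edge (Sum.inl k))) fun k _ => ?_).trans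
    (mul_le_mul_of_nonneg_left hE (Finset.sum_nonneg fun k _ => (G.len_pos _).le))
  have hl := (G.len_pos (P.edge (Sum.inl k))).le
  have := hf.sq_sub_le (P.edge (Sum.inl k)) ⟨le_rfl, hl⟩ ⟨hl, le_rfl⟩
  rwa [P.shaft_len, P.shaft_zero] at this

theorem sq_apply_le_zero (hx0 : x 0 ≤ 1) (hf : G.MemH1 f) (n : ℕ) :
    f (P.v n) ^ 2 ≤ 2 * (G.derivNormSq f + f (P.v 0) ^ 2) := by
  have h := P.sq_sub_le hf (Nat.zero_le n)
  have hD := G.derivNormSq_nonneg f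
  have : (x 0 - x n) * G.derivNormSq f ≤ G.derivNormSq f :=
    mul_le_of_le_one_left hD (by linarith [P.pos n])
  nlinarith [sq_nonneg (f (P.v n) - 2 * f (P.v 0))]

theorem summable_mul_sq_apply (hx0 : x 0 ≤ 1) (hf : G.MemH1 f) :
    Summable fun n => x n * f (P.v n) ^ 2 := by
  have hinj : Function.Injective fun k => P.edge (Sum.inr k) :=
    P.edge.injective.comp Sum.inr_injective
  refine (((hf.summable_edgeMass.comp_injective hinj).mul_left 2).add
    ((hf.summable_edgeEnergy.comp_injective hinj).mul_left 2)).of_nonneg_of_le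
    (fun n => mul_nonneg (P.pos n).le (sq_nonneg _)) fun n => ?_
  have h := hf.len_mul_sq_le (P.edge (Sum.inr n)) ⟨le_rfl, (G.len_pos _).le⟩
  rw [P.tooth_zero, P.len_tooth] at h
  have h1 : x n ≤ 1 := (P.strictAnti.antitone (Nat.zero_le n)).trans hx0
  have h2 : x n ^ 2 ≤ 1 := pow_le_one₀ (P.pos n).le h1
  have := mul_le_mul_of_nonneg_right h2 (edgeEnergy_nonneg f (P.edge (Sum.inr n)))
  simp only [Function.comp_apply]
  linarith

theorem sq_apply_le_of_not_summable (hx0 : x 0 ≤ 1) (hx : ¬ Summable x) (hf : G.MemH1 f)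
    (n : ℕ) : f (P.v n) ^ 2 ≤ x n * G.derivNormSq f := by
  by_contra! hlt
  set D := G.derivNormSq f
  have hD : 0 ≤ D := G.derivNormSq_nonneg f
  have hxD : 0 ≤ x n * D := mul_nonneg (P.pos n).le hD
  have hsq : √(x n * D) < |f (P.v n)| := by
    rw [← Real.sqrt_sq_eq_abs]
    exact Real.sqrt_lt_sqrt hxD hlt
  set δ := |f (P.v n)| - √(x n * D) with hδ
  have hδ0 : 0 < δ := sub_pos.2 hsq
  have hlow (m : ℕ) (hm : n ≤ m) : δ ^ 2 ≤ f (P.v m) ^ 2 := by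
    have h1 : (f (P.v n) - f (P.v m)) ^ 2 ≤ x n * D :=
      (P.sq_sub_le hf hm).trans (mul_le_mul_of_nonneg_right (by linarith [P.pos m]) hD)
    have h2 := Real.abs_le_sqrt h1
    have h3 := abs_sub_abs_le_abs_sub (f (P.v n)) (f (P.v m))
    rw [← sq_abs (f (P.v m))]
    exact pow_le_pow_left₀ hδ0.le (by linarith) 2
  have hs := (summable_nat_add_iff n).2 (P.summable_mul_sq_apply hx0 hf)
  refine hx ((summable_nat_add_iff n).1 ?_)
  refine (hs.mul_left (δ ^ 2)⁻¹).of_nonneg_of_le (fun m => (P.pos _).le) fun m => ?_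
  rw [← div_eq_inv_mul, le_div_iff₀ (by positivity)]
  exact mul_le_mul_of_nonneg_left (hlow _ (Nat.le_add_left n m)) (P.pos _).le

theorem summable_len_shaft : Summable fun n => G.len (P.edge (Sum.inl n)) := by
  refine summable_of_sum_range_le (c := x 0) (fun n => (G.len_pos _).le) fun n => ?_
  simp only [P.len_shaft, Finset.sum_range_sub']
  linarith [P.pos n]

theorem pointControlled (hx0 : x 0 ≤ 1) (hx : Tendsto x atTop (nhds 0))
    (hsum : Summable fun n => x n ^ 2) : G.PointControlled := by
  classical
  let w : ℕ → ℝ := if Summable x then fun _ => 2 else x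
  have hw0 (n : ℕ) : 0 ≤ w n := by
    by_cases h : Summable x
    · simp [w, h]
    · simpa [w, h] using (P.pos n).le
  have hw (f : X → ℝ) (hf : G.MemH1 f) (n : ℕ) :
      f (P.v n) ^ 2 ≤ w n * (G.derivNormSq f + f (P.v 0) ^ 2) := by
    by_cases h : Summable x
    · simpa [w, h] using P.sq_apply_le_zero hx0 hf n
    · simp only [w, h, if_false]
      exact (P.sq_apply_le_of_not_summable hx0 h hf n).trans
        (mul_le_mul_of_nonneg_left (le_add_of_nonneg_right (sq_nonneg _)) (P.pos n).le)
  have hxw : Summable fun n => x n * w n := by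
    by_cases h : Summable x
    · simpa [w, h] using h.mul_right 2
    · simpa [w, h, sq] using hsum
  let a : G.E → ℝ := fun e => Sum.elim (fun _ => 2) w (P.edge.symm e)
  refine PointControlled.of_weights a (fun e => ?_) (P.tendsto_len hx) ?_ (P.v 0)
    fun f hf e => ?_
  · rcases h : P.edge.symm e with n | n
    · simp [a, h]
    · simpa [a, h] using hw0 n
  · rw [← P.edge.summable_iff]
    refine Summable.sum _ ?_ ?_
    · simpa [a, Function.comp_def] using P.summable_len_shaft.mul_right 2
    · simpa [a, Function.comp_def, P.len_tooth] using hxw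
  · obtain ⟨n | n, rfl⟩ := P.edge.surjective e
    · simpa [a, P.shaft_zero] using P.sq_apply_le_zero hx0 hf (n + 1)
    · simpa [a, P.tooth_zero] using hw f hf n

end CombParam

open MetricGraphOn in
/-- For every `α > 1/2`, `H¹(G_α)` of the diagonal comb graph
embeds compactly into `L²(G_α)`; in particular the Neumann extension has compact
resolvent and purely discrete spectrum. -/
theorem statement1 (α : ℝ) (hα : 1 / 2 < α)
    (X : Type) [MetricSpace X] (G : MetricGraphOn X) (hG : IsDiagonalComb G α) :
    G.CompactlyEmbedded {f | G.MemH1 f} ∧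
      G.HasPurelyDiscreteSpectrumOn {f | G.MemH1 f} := by
  obtain ⟨P⟩ := hG.nonempty_combParam
  have hx : Tendsto (fun n : ℕ => ((n : ℝ) + 1) ^ (-α)) atTop (nhds 0) :=
    (tendsto_rpow_neg_atTop (by linarith)).comp
      (tendsto_atTop_add_const_right _ 1 tendsto_natCast_atTop_atTop)
  have hsum : Summable fun n : ℕ => (((n : ℝ) + 1) ^ (-α)) ^ 2 := by
    have h := (summable_nat_add_iff 1).2
      (Real.summable_nat_rpow.2 (show -(2 * α) < -1 by linarith))
    refine h.congr fun n => ?_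
    rw [← Real.rpow_mul_natCast (by positivity)]
    push_cast
    ring_nf
  have hpc : G.PointControlled := P.pointControlled (by simp) hx hsum
  obtain ⟨N, hN⟩ := P.exists_shift_not_tendsto
  exact ⟨hpc.compactlyEmbedded, hpc.hasPurelyDiscreteSpectrumOn
    (exists_linearIndependent (P.tendsto_len hx) (p := fun i => P.v (N + i))
      (P.v_injective.comp (add_right_injective N)) fun i => P.exists_separated hx (hN i))⟩
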